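/- Let X be a GC_5 set of 21 nodes with no maximal line, and assume that no node of X has m-d sequence (5,5,5,3,2). Then: (i) X has no 3-node line, and for each m ∈ {2,4,5} every m-node line is used by exactly m−1 nodes of X; (ii) no two distinct lines used by the same node of X intersect at a node of X. -/

import Mathlib

open MvPolynomial

/-- Evaluation of a bivariate polynomial at a point of the real plane. -/
noncomputable def ev (p : MvPolynomial (Fin 2) ℝ) (A : ℝ × ℝ) : ℝ :=
  MvPolynomial.eval ![A.1, A.2] p

/-- A polynomial of total degree exactly 1, defining a line. -/
def IsLinePoly (l : MvPolynomial (Fin 2) ℝ) : Prop := l.totalDegree = 1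

/-- The line (zero set) defined by a polynomial. -/
def lineSet (l : MvPolynomial (Fin 2) ℝ) : Set (ℝ × ℝ) := {A | ev l A = 0}

/-- The number of nodes of `X` lying on the line defined by `l`. -/
noncomputable def nodesOn (X : Set (ℝ × ℝ)) (l : MvPolynomial (Fin 2) ℝ) : ℕ :=
  (X ∩ lineSet l).ncard

/-- `X` is an `n`-poised set: it has `N = (n+2)(n+1)/2` nodes and the only polynomial of
degree ≤ n vanishing on all of `X` is the zero polynomial. -/
def Poised (n : ℕ) (X : Set (ℝ × ℝ)) : Prop :=
  X.Finite ∧ X.ncard = (n + 2) * (n + 1) / 2 ∧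
    ∀ p : MvPolynomial (Fin 2) ℝ, p.totalDegree ≤ n → (∀ A ∈ X, ev p A = 0) → p = 0

/-- `p` is an `n`-fundamental polynomial of the node `A` with respect to `X`. -/
def IsFund (n : ℕ) (X : Set (ℝ × ℝ)) (A : ℝ × ℝ) (p : MvPolynomial (Fin 2) ℝ) : Prop :=
  p.totalDegree ≤ n ∧ ev p A = 1 ∧ ∀ B ∈ X, B ≠ A → ev p B = 0

/-- `X` is a `GC_n` set: it is `n`-poised and each fundamental polynomial is a product of
`n` linear (degree-1) polynomials. -/
def GCSet (n : ℕ) (X : Set (ℝ × ℝ)) : Prop :=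
  Poised n X ∧ ∀ A ∈ X, ∃ p : MvPolynomial (Fin 2) ℝ, IsFund n X A p ∧
    ∃ f : Fin n → MvPolynomial (Fin 2) ℝ, (∀ i, IsLinePoly (f i)) ∧ p = ∏ i, f i

/-- The node `A` uses the line `l`: the linear polynomial `l` divides a fundamental
polynomial of `A`. -/
def Uses (n : ℕ) (X : Set (ℝ × ℝ)) (A : ℝ × ℝ) (l : MvPolynomial (Fin 2) ℝ) : Prop :=
  ∃ p, IsFund n X A p ∧ l ∣ p

/-- `X` has no maximal line, i.e. no line passes through `n+1` nodes of `X`. -/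
def NoMaximalLine (n : ℕ) (X : Set (ℝ × ℝ)) : Prop :=
  ∀ l : MvPolynomial (Fin 2) ℝ, IsLinePoly l → nodesOn X l ≠ n + 1

/-- Number of nodes of `X` on the line `l` which do not lie on any of the lines
`L 0, …, L (s-1)` (the primary node count of `l` at step `s`). -/
noncomputable def resCount (X : Set (ℝ × ℝ)) (L : Fin 5 → MvPolynomial (Fin 2) ℝ)
    (s : Fin 5) (l : MvPolynomial (Fin 2) ℝ) : ℕ :=
  {B ∈ X | ev l B = 0 ∧ ∀ i : Fin 5, i < s → ev (L i) B ≠ 0}.ncard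

/-- `L` is an m-line sequence of the node `A` of the `GC_5` set `X`: it enumerates the five
distinct used lines of `A` (a fundamental polynomial of `A` is, up to a constant, the
product of the `L i`), ordered greedily: at each step `s` the line `L s` has maximal
primary node count among the remaining used lines. -/
def MLineSeq (X : Set (ℝ × ℝ)) (A : ℝ × ℝ) (L : Fin 5 → MvPolynomial (Fin 2) ℝ) : Prop :=
  (∀ i, IsLinePoly (L i)) ∧
  (∀ i j : Fin 5, i ≠ j → lineSet (L i) ≠ lineSet (L j)) ∧
  (∃ p : MvPolynomial (Fin 2) ℝ, IsFund 5 X A p ∧ ∃ c : ℝ, p = MvPolynomial.C c * ∏ i, L i) ∧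
  (∀ s t : Fin 5, s ≤ t → resCount X L s (L t) ≤ resCount X L s (L s))

/-- The node `A` has m-distribution sequence `k`. -/
def HasMDSeq (X : Set (ℝ × ℝ)) (A : ℝ × ℝ) (k : Fin 5 → ℕ) : Prop :=
  ∃ L : Fin 5 → MvPolynomial (Fin 2) ℝ, MLineSeq X A L ∧ ∀ s, resCount X L s (L s) = k s

lemma ev_add (p q : MvPolynomial (Fin 2) ℝ) (A : ℝ × ℝ) : ev (p + q) A = ev p A + ev q A := by
  simp [ev]

lemma ev_mul (p q : MvPolynomial (Fin 2) ℝ) (A : ℝ × ℝ) : ev (p * q) A = ev p A * ev q A := by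
  simp [ev]

lemma ev_C (c : ℝ) (A : ℝ × ℝ) : ev (C c) A = c := by simp [ev]

lemma ev_zero (A : ℝ × ℝ) : ev 0 A = 0 := by simp [ev]

lemma ev_prod {ι : Type*} (s : Finset ι) (f : ι → MvPolynomial (Fin 2) ℝ) (A : ℝ × ℝ) :
    ev (∏ i ∈ s, f i) A = ∏ i ∈ s, ev (f i) A := by
  simp [ev, map_prod]

lemma ev_sum {ι : Type*} (s : Finset ι) (f : ι → MvPolynomial (Fin 2) ℝ) (A : ℝ × ℝ) :
    ev (∑ i ∈ s, f i) A = ∑ i ∈ s, ev (f i) A := by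
  simp [ev, map_sum]

/-- The affine polynomial `a x + b y + c`. -/
noncomputable def affinePoly (a b c : ℝ) : MvPolynomial (Fin 2) ℝ :=
  C a * X 0 + C b * X 1 + C c

lemma ev_affinePoly (a b c : ℝ) (A : ℝ × ℝ) : ev (affinePoly a b c) A = a * A.1 + b * A.2 + c := by
  simp [ev, affinePoly]

lemma totalDegree_affinePoly_le (a b c : ℝ) : (affinePoly a b c).totalDegree ≤ 1 := by
  unfold affinePoly
  refine (totalDegree_add _ _).trans (max_le ((totalDegree_add _ _).trans (max_le ?_ ?_)) ?_)
  · refine (totalDegree_mul _ _).trans ?_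
    simp
  · refine (totalDegree_mul _ _).trans ?_
    simp
  · simp

lemma affinePoly_ne_zero {a b c : ℝ} (h : a ≠ 0 ∨ b ≠ 0 ∨ c ≠ 0) : affinePoly a b c ≠ 0 := by
  intro h0
  have h1 := ev_affinePoly a b c (0, 0)
  have h2 := ev_affinePoly a b c (1, 0)
  have h3 := ev_affinePoly a b c (0, 1)
  rw [h0, ev_zero] at h1 h2 h3
  simp only [mul_zero, mul_one] at h1 h2 h3
  rcases h with h | h | h <;> apply h <;> linarith

lemma isLinePoly_affinePoly {a b c : ℝ} (h : a ≠ 0 ∨ b ≠ 0) : IsLinePoly (affinePoly a b c) := by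
  refine le_antisymm (totalDegree_affinePoly_le a b c) ?_
  by_contra hlt
  have h0 : (affinePoly a b c).totalDegree = 0 := by omega
  rw [totalDegree_eq_zero_iff_eq_C] at h0
  have h1 := ev_affinePoly a b c (0, 0)
  have h2 := ev_affinePoly a b c (1, 0)
  have h3 := ev_affinePoly a b c (0, 1)
  rw [h0, ev_C] at h1 h2 h3
  simp only [mul_zero, mul_one] at h1 h2 h3
  rcases h with h | h <;> apply h <;> linarith

lemma eq_affinePoly_of_totalDegree_le_one {l : MvPolynomial (Fin 2) ℝ} (hl : l.totalDegree ≤ 1) :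
    ∃ a b c : ℝ, l = affinePoly a b c := by
  refine ⟨coeff (Finsupp.single 0 1) l, coeff (Finsupp.single 1 1) l, coeff 0 l, ?_⟩
  ext m
  have key : m = 0 ∨ m = Finsupp.single 0 1 ∨ m = Finsupp.single 1 1 ∨ 1 < m.sum fun _ e => e := by
    have hs : (m.sum fun _ e => e) = m 0 + m 1 := by
      rw [Finsupp.sum_fintype _ _ (fun _ => rfl), Fin.sum_univ_two]
    rw [hs]
    by_cases h2 : 1 < m 0 + m 1
    · exact Or.inr (Or.inr (Or.inr h2))
    have : (m 0 = 0 ∧ m 1 = 0) ∨ (m 0 = 1 ∧ m 1 = 0) ∨ (m 0 = 0 ∧ m 1 = 1) := by omega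
    rcases this with ⟨h, h'⟩ | ⟨h, h'⟩ | ⟨h, h'⟩
    · left; ext i; fin_cases i <;> simp [h, h']
    · right; left; ext i; fin_cases i <;> simp [h, h']
    · right; right; left; ext i; fin_cases i <;> simp [h, h']
  have h01 : (Finsupp.single (0 : Fin 2) 1 : Fin 2 →₀ ℕ) ≠ Finsupp.single 1 1 := by
    intro h
    have := DFunLike.congr_fun h 0
    simp at this
  rcases key with rfl | rfl | rfl | h
  · simp [affinePoly]
  · simp [affinePoly, coeff_C_mul, coeff_X, coeff_C, h01.symm,
      (Finsupp.single_ne_zero.2 one_ne_zero).symm]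
  · simp [affinePoly, coeff_C_mul, coeff_X, coeff_C, h01,
      (Finsupp.single_ne_zero.2 one_ne_zero).symm]
  · rw [coeff_eq_zero_of_totalDegree_lt, coeff_eq_zero_of_totalDegree_lt]
    · exact lt_of_le_of_lt (totalDegree_affinePoly_le _ _ _) h
    · exact lt_of_le_of_lt hl h

lemma IsLinePoly.exists_eq_affinePoly {l : MvPolynomial (Fin 2) ℝ} (hl : IsLinePoly l) :
    ∃ a b c : ℝ, (a ≠ 0 ∨ b ≠ 0) ∧ l = affinePoly a b c := by
  obtain ⟨a, b, c, rfl⟩ := eq_affinePoly_of_totalDegree_le_one (le_of_eq hl)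
  refine ⟨a, b, c, ?_, rfl⟩
  by_contra! h
  obtain ⟨rfl, rfl⟩ := h
  have : affinePoly 0 0 c = C c := by simp [affinePoly]
  rw [IsLinePoly, this, totalDegree_C] at hl
  exact zero_ne_one hl

lemma IsLinePoly.ne_zero {l : MvPolynomial (Fin 2) ℝ} (hl : IsLinePoly l) : l ≠ 0 := by
  rintro rfl
  simp [IsLinePoly] at hl

lemma IsLinePoly.prime {l : MvPolynomial (Fin 2) ℝ} (hl : IsLinePoly l) : Prime l := by
  refine (irreducible_of_totalDegree_eq_one hl fun x hx => ?_).prime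
  rcases eq_or_ne x 0 with rfl | h
  · refine absurd ?_ hl.ne_zero
    ext m
    simpa using hx m
  · exact isUnit_iff_ne_zero.2 h

/-- A polynomial vanishing on a line is divisible by the polynomial defining the line. -/
lemma IsLinePoly.dvd_of_vanish {l p : MvPolynomial (Fin 2) ℝ} (hl : IsLinePoly l)
    (h : ∀ A, ev l A = 0 → ev p A = 0) : l ∣ p := by
  obtain ⟨a, b, c, hab, rfl⟩ := hl.exists_eq_affinePoly
  have hpos : a ^ 2 + b ^ 2 ≠ 0 := by
    rcases hab with h | h <;> positivity
  set l := affinePoly a b c with hldef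
  set φ : MvPolynomial (Fin 2) ℝ →ₐ[ℝ] MvPolynomial (Fin 2) ℝ :=
    aeval ![X 0 - C (a / (a ^ 2 + b ^ 2)) * l, X 1 - C (b / (a ^ 2 + b ^ 2)) * l] with hφ
  have hev : ∀ (q : MvPolynomial (Fin 2) ℝ) (A : ℝ × ℝ), ev (φ q) A =
      ev q (A.1 - a / (a ^ 2 + b ^ 2) * ev l A, A.2 - b / (a ^ 2 + b ^ 2) * ev l A) := by
    intro q A
    induction q using MvPolynomial.induction_on with
    | C r => simp [hφ, ev]
    | add p q hp hq => rw [map_add, ev_add, ev_add, hp, hq]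
    | mul_X p i hp =>
      rw [map_mul, ev_mul, ev_mul, hp]
      congr 1
      fin_cases i <;> simp [hφ, ev]
  have hzero : φ p = 0 := by
    refine MvPolynomial.funext fun x => ?_
    have hx : x = ![((x 0, x 1) : ℝ × ℝ).1, ((x 0, x 1) : ℝ × ℝ).2] := by
      ext i; fin_cases i <;> rfl
    rw [map_zero, hx]
    change ev (φ p) (x 0, x 1) = 0
    rw [hev]
    apply h
    simp only [hldef, ev_affinePoly]
    field_simp
    ring
  have hquot : (Ideal.Quotient.mkₐ ℝ (Ideal.span {l})).comp φ =
      Ideal.Quotient.mkₐ ℝ (Ideal.span {l}) := by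
    refine MvPolynomial.algHom_ext fun i => ?_
    simp only [AlgHom.comp_apply, Ideal.Quotient.mkₐ_eq_mk]
    rw [Ideal.Quotient.eq, Ideal.mem_span_singleton]
    fin_cases i
    · simp [hφ]
    · simp [hφ]
  have := DFunLike.congr_fun hquot p
  simp only [AlgHom.comp_apply, hzero, map_zero, Ideal.Quotient.mkₐ_eq_mk] at this
  rw [eq_comm, Ideal.Quotient.eq_zero_iff_mem, Ideal.mem_span_singleton] at this
  exact this

/-- A polynomial of degree at most `k` with more than `k` zeros on a line is divisible by the
polynomial defining the line. -/
lemma IsLinePoly.dvd_of_card_lt {l p : MvPolynomial (Fin 2) ℝ} (hl : IsLinePoly l) {k : ℕ}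
    (hp : p.totalDegree ≤ k) (T : Finset (ℝ × ℝ)) (hT : k < T.card)
    (hTl : ∀ A ∈ T, ev l A = 0) (hTp : ∀ A ∈ T, ev p A = 0) : l ∣ p := by
  obtain ⟨a, b, c, hab, rfl⟩ := hl.exists_eq_affinePoly
  have hpos : a ^ 2 + b ^ 2 ≠ 0 := by
    rcases hab with h | h <;> positivity
  set s := a ^ 2 + b ^ 2 with hs
  set f : Polynomial ℝ := aeval ![Polynomial.C (-(a * c / s)) + Polynomial.C (-b) * Polynomial.X,
    Polynomial.C (-(b * c / s)) + Polynomial.C a * Polynomial.X] p with hf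
  have hev : ∀ t, f.eval t = ev p (-(a * c / s) - b * t, -(b * c / s) + a * t) := by
    intro t
    rw [hf]
    clear hf hTp hp f
    induction p using MvPolynomial.induction_on with
    | C r => simp [ev]
    | add p q hp hq => rw [map_add, ev_add, Polynomial.eval_add, hp, hq]
    | mul_X p i hp =>
      rw [map_mul, ev_mul, Polynomial.eval_mul, hp]
      congr 1
      fin_cases i
      · simp [ev]
        ring
      · simp [ev]
  have hdeg : f.natDegree ≤ k := by
    rw [hf]
    refine (aeval_natDegree_le p hp _ fun i => ?_).trans_eq (mul_one k)
    fin_cases i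
    · exact (congrArg _ (add_comm _ _)).trans_le Polynomial.natDegree_linear_le
    · exact (congrArg _ (add_comm _ _)).trans_le Polynomial.natDegree_linear_le
  have hpar : ∀ A : ℝ × ℝ, ev (affinePoly a b c) A = 0 →
      (-(a * c / s) - b * ((a * A.2 - b * A.1) / s),
        -(b * c / s) + a * ((a * A.2 - b * A.1) / s)) = A := by
    intro A hA
    rw [ev_affinePoly] at hA
    have hc : c = -(a * A.1 + b * A.2) := by linarith
    ext
    · simp only [hc]
      field_simp
      rw [hs]; ring
    · simp only [hc]
      field_simp
      rw [hs]; ring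
  have hf0 : f = 0 := by
    refine Polynomial.eq_zero_of_natDegree_lt_card_of_eval_eq_zero' f
      (T.image fun A => (a * A.2 - b * A.1) / s) ?_ ?_
    · intro x hx
      obtain ⟨A, hA, rfl⟩ := Finset.mem_image.1 hx
      rw [hev, hpar A (hTl A hA), hTp A hA]
    · rw [Finset.card_image_of_injOn]
      · exact lt_of_le_of_lt hdeg hT
      · intro A hA B hB hAB
        simp only at hAB
        rw [← hpar A (hTl A hA), ← hpar B (hTl B hB), hAB]
  refine hl.dvd_of_vanish fun A hA => ?_
  rw [← hpar A hA, ← hev, hf0, Polynomial.eval_zero]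

lemma IsLinePoly.lineSet_eq_of_dvd {l₁ l₂ : MvPolynomial (Fin 2) ℝ} (h₁ : IsLinePoly l₁)
    (h₂ : IsLinePoly l₂) (h : l₁ ∣ l₂) : lineSet l₁ = lineSet l₂ := by
  obtain ⟨g, rfl⟩ := h
  have hg : g ≠ 0 := right_ne_zero_of_mul h₂.ne_zero
  have hd := totalDegree_mul_of_isDomain h₁.ne_zero hg
  rw [IsLinePoly] at h₁ h₂
  have hg0 : g.totalDegree = 0 := by omega
  rw [totalDegree_eq_zero_iff_eq_C] at hg0
  rw [hg0] at hg ⊢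
  have hc : coeff 0 g ≠ 0 := fun h => hg (by rw [h, C_0])
  ext A
  simp [lineSet, ev_mul, ev_C, hc]

lemma IsLinePoly.dvd_of_lineSet_subset {l₁ l₂ : MvPolynomial (Fin 2) ℝ} (h₁ : IsLinePoly l₁)
    (h : lineSet l₁ ⊆ lineSet l₂) : l₁ ∣ l₂ :=
  h₁.dvd_of_vanish fun _ hA => h hA

lemma IsLinePoly.lineSet_eq_of_two_points {l₁ l₂ : MvPolynomial (Fin 2) ℝ} (h₁ : IsLinePoly l₁)
    (h₂ : IsLinePoly l₂) {P Q : ℝ × ℝ} (hPQ : P ≠ Q) (hP₁ : ev l₁ P = 0) (hP₂ : ev l₂ P = 0)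
    (hQ₁ : ev l₁ Q = 0) (hQ₂ : ev l₂ Q = 0) : lineSet l₁ = lineSet l₂ := by
  classical
  refine h₁.lineSet_eq_of_dvd h₂ (h₁.dvd_of_card_lt (le_of_eq h₂) {P, Q} ?_ ?_ ?_)
  · rw [Finset.card_pair hPQ]; norm_num
  · simp [hP₁, hQ₁]
  · simp [hP₂, hQ₂]

lemma exists_isLinePoly_through (P Q : ℝ × ℝ) :
    ∃ l, IsLinePoly l ∧ ev l P = 0 ∧ ev l Q = 0 := by
  by_cases h : P = Q
  · subst h
    refine ⟨affinePoly 1 0 (-P.1), isLinePoly_affinePoly (by simp), ?_, ?_⟩ <;>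
      simp [ev_affinePoly]
  · refine ⟨affinePoly (Q.2 - P.2) (P.1 - Q.1) (P.2 * Q.1 - P.1 * Q.2),
      isLinePoly_affinePoly ?_, ?_, ?_⟩
    · by_contra! h'
      exact h (Prod.ext (by linarith [h'.2]) (by linarith [h'.1]))
    · rw [ev_affinePoly]; ring
    · rw [ev_affinePoly]; ring

lemma IsLinePoly.infinite_lineSet {l : MvPolynomial (Fin 2) ℝ} (hl : IsLinePoly l) :
    (lineSet l).Infinite := by
  obtain ⟨a, b, c, hab, rfl⟩ := hl.exists_eq_affinePoly
  have hpos : a ^ 2 + b ^ 2 ≠ 0 := by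
    rcases hab with h | h <;> positivity
  refine Set.infinite_of_injective_forall_mem (f := fun t : ℝ =>
    ((-(a * c / (a ^ 2 + b ^ 2)) - b * t, -(b * c / (a ^ 2 + b ^ 2)) + a * t) : ℝ × ℝ)) ?_ ?_
  · intro s t hst
    simp only [Prod.mk.injEq] at hst
    rcases hab with h | h
    · exact mul_left_cancel₀ h (by linarith [hst.2])
    · exact mul_left_cancel₀ h (by linarith [hst.1])
  · intro t
    simp only [lineSet, Set.mem_ofPred_eq, ev_affinePoly]
    field_simp
    ring

/-- A line contains arbitrarily many points avoiding finitely many points and finitely many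
other lines. -/
lemma IsLinePoly.exists_finset_avoiding {l : MvPolynomial (Fin 2) ℝ} (hl : IsLinePoly l)
    {ι : Type*} [Finite ι] (g : ι → MvPolynomial (Fin 2) ℝ) (hg : ∀ i, IsLinePoly (g i))
    (hne : ∀ i, lineSet l ≠ lineSet (g i)) (W : Finset (ℝ × ℝ)) (n : ℕ) :
    ∃ E : Finset (ℝ × ℝ), E.card = n ∧ (∀ P ∈ E, ev l P = 0) ∧ (∀ P ∈ E, P ∉ W) ∧
      ∀ P ∈ E, ∀ i, ev (g i) P ≠ 0 := by
  have hfin : ((W : Set (ℝ × ℝ)) ∪ ⋃ i, lineSet l ∩ lineSet (g i)).Finite := by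
    refine W.finite_toSet.union (Set.finite_iUnion fun i => Set.Subsingleton.finite ?_)
    intro P hP Q hQ
    by_contra hPQ
    exact hne i (hl.lineSet_eq_of_two_points (hg i) hPQ hP.1 hP.2 hQ.1 hQ.2)
  obtain ⟨E, hE, hcard⟩ := (hl.infinite_lineSet.sdiff hfin).exists_subset_card_eq n
  refine ⟨E, hcard, fun P hP => (hE hP).1, fun P hP hW => (hE hP).2 (Or.inl hW), ?_⟩
  intro P hP i h
  exact (hE hP).2 (Or.inr (Set.mem_iUnion.2 ⟨i, (hE hP).1, h⟩))

lemma IsLinePoly.exists_mul_of_card_lt {l p : MvPolynomial (Fin 2) ℝ} (hl : IsLinePoly l) {k : ℕ}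
    (hp : p.totalDegree ≤ k) (T : Finset (ℝ × ℝ)) (hT : k < T.card)
    (hTl : ∀ A ∈ T, ev l A = 0) (hTp : ∀ A ∈ T, ev p A = 0) :
    ∃ q, p = l * q ∧ q.totalDegree ≤ k - 1 := by
  obtain ⟨q, rfl⟩ := hl.dvd_of_card_lt hp T hT hTl hTp
  refine ⟨q, rfl, ?_⟩
  by_cases hq : q = 0
  · simp [hq]
  · rw [totalDegree_mul_of_isDomain hl.ne_zero hq, hl] at hp
    omega

/-- A polynomial of degree at most `4` vanishing at `5, 4, 3, 2` points of four lines, where each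
line contributes points outside the previous ones, vanishes on these lines. -/
lemma ev_eq_zero_of_line_chain {F : MvPolynomial (Fin 2) ℝ} (hF : F.totalDegree ≤ 4)
    (c : Fin 4 → MvPolynomial (Fin 2) ℝ) (hc : ∀ i, IsLinePoly (c i))
    (T : Fin 4 → Finset (ℝ × ℝ)) (hT : ∀ i, ∀ P ∈ T i, ev (c i) P = 0)
    (hT' : ∀ i, ∀ j < i, ∀ P ∈ T i, ev (c j) P ≠ 0) (hcard : ∀ i : Fin 4, 5 - (i : ℕ) ≤ (T i).card)
    (hFT : ∀ i, ∀ P ∈ T i, ev F P = 0) {A : ℝ × ℝ} {i : Fin 4} (hA : ev (c i) A = 0) :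
    ev F A = 0 := by
  obtain ⟨G₀, rfl, h₀⟩ := (hc 0).exists_mul_of_card_lt hF (T 0) (hcard 0) (hT 0) (hFT 0)
  obtain ⟨G₁, rfl, h₁⟩ := (hc 1).exists_mul_of_card_lt h₀ (T 1) (hcard 1) (hT 1) fun P hP => by
    have h := hFT 1 P hP
    simpa only [ev_mul, mul_eq_zero, hT' 1 0 (by decide) P hP, false_or] using h
  obtain ⟨G₂, rfl, h₂⟩ := (hc 2).exists_mul_of_card_lt h₁ (T 2) (hcard 2) (hT 2) fun P hP => by
    have h := hFT 2 P hP
    simpa only [ev_mul, mul_eq_zero, hT' 2 0 (by decide) P hP, hT' 2 1 (by decide) P hP,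
      false_or] using h
  obtain ⟨G₃, rfl, h₃⟩ := (hc 3).exists_mul_of_card_lt h₂ (T 3) (hcard 3) (hT 3) fun P hP => by
    have h := hFT 3 P hP
    simpa only [ev_mul, mul_eq_zero, hT' 3 0 (by decide) P hP, hT' 3 1 (by decide) P hP,
      hT' 3 2 (by decide) P hP, false_or] using h
  fin_cases i <;> simp_all [ev_mul]

/-- If quartics `q D`, one for each `D ∈ S`, with `q D` vanishing at `S \ {D}` but not at `D`,
all vanish at `T i` on the lines `c i`, and these lines cover `S`, then `S` is no larger than the
number of points missing from the `T i` to determine the quartic `∏ c i`. -/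
lemma card_le_sum_deficit (c : Fin 4 → MvPolynomial (Fin 2) ℝ) (hc : ∀ i, IsLinePoly (c i))
    (hne : ∀ i j, i ≠ j → lineSet (c i) ≠ lineSet (c j)) (S : Finset (ℝ × ℝ))
    (q : ℝ × ℝ → MvPolynomial (Fin 2) ℝ) (hq : ∀ D ∈ S, (q D).totalDegree ≤ 4)
    (hqD : ∀ D ∈ S, ev (q D) D ≠ 0) (hqS : ∀ D ∈ S, ∀ E ∈ S, E ≠ D → ev (q D) E = 0)
    (T : Fin 4 → Finset (ℝ × ℝ)) (hT : ∀ i, ∀ P ∈ T i, ev (c i) P = 0)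
    (hT' : ∀ i, ∀ j < i, ∀ P ∈ T i, ev (c j) P ≠ 0)
    (hqT : ∀ D ∈ S, ∀ i, ∀ P ∈ T i, ev (q D) P = 0) (hS : ∀ D ∈ S, ∃ i, ev (c i) D = 0) :
    S.card ≤ ∑ i : Fin 4, (5 - (i : ℕ) - (T i).card) := by
  classical
  by_contra! hlt
  have hE : ∀ i : Fin 4, ∃ E : Finset (ℝ × ℝ), E.card = 5 - (i : ℕ) - (T i).card ∧
      (∀ P ∈ E, ev (c i) P = 0) ∧ (∀ P ∈ E, P ∉ T i) ∧
      ∀ P ∈ E, ∀ j : {j // j < i}, ev (c j) P ≠ 0 := fun i =>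
    (hc i).exists_finset_avoiding (fun j : {j // j < i} => c j) (fun j => hc j)
      (fun j => hne i j j.2.ne') (T i) _
  choose E hEcard hEc hET hEne using hE
  set M : Matrix (Finset.univ.biUnion E) S ℝ := fun P D => ev (q D) P with hM
  have hker : LinearMap.ker M.mulVecLin ≠ ⊥ := by
    apply LinearMap.ker_ne_bot_of_finrank_lt
    simp only [Module.finrank_fintype_fun_eq_card, Fintype.card_coe]
    refine lt_of_le_of_lt Finset.card_biUnion_le ?_
    simpa only [hEcard] using hlt
  obtain ⟨κ, hκ, hκ0⟩ := Submodule.exists_mem_ne_zero_of_ne_bot hker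
  have hκE : ∀ i, ∀ P ∈ E i, ∑ D : S, κ D * ev (q D) P = 0 := by
    intro i P hP
    have h := congrFun (LinearMap.mem_ker.1 hκ)
      ⟨P, Finset.mem_biUnion.2 ⟨i, Finset.mem_univ i, hP⟩⟩
    rw [Matrix.mulVecLin_apply] at h
    exact (Finset.sum_congr rfl fun D _ => mul_comm _ _).trans h
  set F : MvPolynomial (Fin 2) ℝ := ∑ D : S, C (κ D) * q D with hF
  have hFev : ∀ P, ev F P = ∑ D : S, κ D * ev (q D) P := by
    intro P
    simp [hF, ev_sum, ev_mul, ev_C]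
  have hFdeg : F.totalDegree ≤ 4 := by
    refine (totalDegree_finsetSum _ _).trans (Finset.sup_le fun D _ => ?_)
    refine (totalDegree_mul _ _).trans ?_
    simpa using hq D D.2
  have hvan : ∀ i, ∀ A, ev (c i) A = 0 → ev F A = 0 := by
    intro i A hA
    refine ev_eq_zero_of_line_chain hFdeg c hc (fun i => T i ∪ E i) ?_ ?_ ?_ ?_ hA
    · intro i P hP
      rcases Finset.mem_union.1 hP with hP | hP
      exacts [hT i P hP, hEc i P hP]
    · intro i j hj P hP
      rcases Finset.mem_union.1 hP with hP | hP
      exacts [hT' i j hj P hP, hEne i P hP ⟨j, hj⟩]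
    · intro i
      rw [Finset.card_union_of_disjoint
        (Finset.disjoint_left.2 fun P hP hP' => hET i P hP' hP), hEcard]
      omega
    · intro i P hP
      rw [hFev]
      rcases Finset.mem_union.1 hP with hP | hP
      · exact Finset.sum_eq_zero fun D _ => by rw [hqT D D.2 i P hP, mul_zero]
      · exact hκE i P hP
  apply hκ0
  funext D
  obtain ⟨i, hi⟩ := hS D D.2
  have h := hvan i D hi
  rw [hFev, Finset.sum_eq_single D] at h
  · exact (mul_eq_zero.1 h).resolve_right (hqD D D.2)
  · intro E _ hED
    rw [hqS E E.2 D D.2 fun h => hED (Subtype.ext h.symm), mul_zero]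
  · simp

/-- Greedy ordering of finitely many predicates: at each step the next predicate captures as many
elements of `Z` not captured before as any of the remaining ones. -/
lemma exists_greedy_perm {α : Type*} {n : ℕ} (Z : Finset α) (p : Fin n → α → Prop) :
    ∃ σ : Equiv.Perm (Fin n), ∀ i t : Fin n, i ≤ t →
      {P ∈ (Z : Set α) | p (σ t) P ∧ ∀ j < i, ¬ p (σ j) P}.ncard ≤
        {P ∈ (Z : Set α) | p (σ i) P ∧ ∀ j < i, ¬ p (σ j) P}.ncard := by
  suffices h : ∀ k : ℕ, ∃ σ : Equiv.Perm (Fin n), ∀ i t : Fin n, (i : ℕ) < k → i ≤ t →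
      {P ∈ (Z : Set α) | p (σ t) P ∧ ∀ j < i, ¬ p (σ j) P}.ncard ≤
        {P ∈ (Z : Set α) | p (σ i) P ∧ ∀ j < i, ¬ p (σ j) P}.ncard by
    obtain ⟨σ, hσ⟩ := h n
    exact ⟨σ, fun i t => hσ i t i.2⟩
  intro k
  induction k with
  | zero => exact ⟨1, fun i t hi => absurd hi (Nat.not_lt_zero _)⟩
  | succ k ih =>
    obtain ⟨σ, hσ⟩ := ih
    by_cases hk : k < n
    swap
    · exact ⟨σ, fun i t _ => hσ i t (by omega)⟩
    set κ : Fin n := ⟨k, hk⟩ with hκ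
    obtain ⟨m, hm, hmax⟩ := (Finset.Ici κ).exists_max_image
      (fun t => {P ∈ (Z : Set α) | p (σ t) P ∧ ∀ j < κ, ¬ p (σ j) P}.ncard)
      ⟨κ, Finset.mem_Ici.2 le_rfl⟩
    rw [Finset.mem_Ici] at hm
    have hlow : ∀ j < κ, Equiv.swap κ m j = j := fun j hj =>
      Equiv.swap_apply_of_ne_of_ne hj.ne (hj.trans_le hm).ne
    have hhigh : ∀ i ≤ κ, ∀ t, i ≤ t → i ≤ Equiv.swap κ m t := by
      intro i hi t ht
      rcases Equiv.swap_apply_eq_iff.1 (rfl : Equiv.swap κ m t = _) with h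
      by_cases h1 : t = κ
      · rw [h1, Equiv.swap_apply_left]; exact hi.trans hm
      by_cases h2 : t = m
      · rw [h2, Equiv.swap_apply_right]; exact hi
      rwa [Equiv.swap_apply_of_ne_of_ne h1 h2]
    refine ⟨(Equiv.swap κ m).trans σ, fun i t hi hit => ?_⟩
    have hiκ : i ≤ κ := Fin.le_def.2 (Nat.lt_succ_iff.1 hi)
    have hset : ∀ s : Fin n, {P ∈ (Z : Set α) | p ((Equiv.swap κ m).trans σ s) P ∧
        ∀ j < i, ¬ p ((Equiv.swap κ m).trans σ j) P} =
        {P ∈ (Z : Set α) | p (σ (Equiv.swap κ m s)) P ∧ ∀ j < i, ¬ p (σ j) P} := by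
      intro s
      ext P
      refine and_congr_right fun _ => and_congr_right fun _ => forall_congr' fun j =>
        forall_congr' fun hj => ?_
      rw [Equiv.trans_apply, hlow j (hj.trans_le hiκ)]
    rw [hset, hset]
    rcases hiκ.lt_or_eq with hlt | rfl
    · rw [hlow i hlt]
      exact hσ i _ (Fin.lt_def.1 hlt) (hhigh i hiκ t hit)
    · rw [Equiv.swap_apply_left]
      exact hmax _ (Finset.mem_Ici.2 (hhigh _ le_rfl t hit))

section GCSets

variable {X : Finset (ℝ × ℝ)} {A : ℝ × ℝ} {l : MvPolynomial (Fin 2) ℝ}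

lemma IsFund.unique {p q : MvPolynomial (Fin 2) ℝ} (hX : GCSet 5 (X : Set (ℝ × ℝ)))
    (hp : IsFund 5 X A p) (hq : IsFund 5 X A q) : p = q := by
  rw [← sub_eq_zero]
  refine hX.1.2.2 _ ((totalDegree_sub _ _).trans (max_le hp.1 hq.1)) fun B hB => ?_
  have h : ev (p - q) B = ev p B - ev q B := by simp [ev]
  rw [h]
  by_cases hBA : B = A
  · rw [hBA, hp.2.1, hq.2.1, sub_self]
  · rw [hp.2.2 B hB hBA, hq.2.2 B hB hBA, sub_self]

lemma GCSet.card_eq (hX : GCSet 5 (X : Set (ℝ × ℝ))) : X.card = 21 := by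
  have h := hX.1.2.1
  rw [Set.ncard_coe_finset] at h
  exact h

/-- A user of a line has a quartic that completes the line to its fundamental polynomial. -/
lemma Uses.exists_quartic (hl : IsLinePoly l) (h : Uses 5 X A l) :
    ∃ q : MvPolynomial (Fin 2) ℝ, q.totalDegree ≤ 4 ∧ ev l A ≠ 0 ∧ ev q A ≠ 0 ∧
      ∀ B ∈ X, B ≠ A → ev l B = 0 ∨ ev q B = 0 := by
  obtain ⟨p, hp, q, rfl⟩ := h
  have hA : ev l A * ev q A = 1 := by rw [← ev_mul]; exact hp.2.1
  have hqA : ev q A ≠ 0 := right_ne_zero_of_mul_eq_one hA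
  refine ⟨q, ?_, left_ne_zero_of_mul_eq_one hA, hqA, fun B hB hBA => ?_⟩
  · have h1 := hp.1
    rw [totalDegree_mul_of_isDomain hl.ne_zero (by rintro rfl; exact hqA (ev_zero A)), hl] at h1
    omega
  · rw [← mul_eq_zero, ← ev_mul]
    exact hp.2.2 B hB hBA

/-- A quartic together with a line cannot vanish at all nodes. -/
lemma GCSet.eq_zero_of_vanish {M q : MvPolynomial (Fin 2) ℝ} (hX : GCSet 5 (X : Set (ℝ × ℝ)))
    (hM : IsLinePoly M) (hq : q.totalDegree ≤ 4) (h : ∀ B ∈ X, ev M B = 0 ∨ ev q B = 0) :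
    q = 0 := by
  refine (mul_eq_zero.1 (hX.1.2.2 (M * q) ?_ fun B hB => ?_)).resolve_left hM.ne_zero
  · refine (totalDegree_mul _ _).trans ?_
    rw [hM]
    omega
  · rw [ev_mul, mul_eq_zero]
    exact h B hB

lemma Uses.exists_isFund_prod (hX : GCSet 5 (X : Set (ℝ × ℝ))) (hA : A ∈ X) (hl : IsLinePoly l)
    (h : Uses 5 X A l) : ∃ g : Fin 4 → MvPolynomial (Fin 2) ℝ, (∀ i, IsLinePoly (g i)) ∧
      ∃ c : ℝ, IsFund 5 X A (C c * (l * ∏ i, g i)) := by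
  obtain ⟨p, hp, f, hf, hpf⟩ := hX.2 A hA
  obtain ⟨p', hp', hdvd⟩ := h
  rw [hp'.unique hX hp, hpf, hl.prime.dvd_finsetProd_iff] at hdvd
  obtain ⟨i, -, u, hu⟩ := hdvd
  have hu0 : u ≠ 0 := by
    rintro rfl
    exact (hf i).ne_zero (by rw [hu, mul_zero])
  have hd := hf i
  rw [IsLinePoly, hu, totalDegree_mul_of_isDomain hl.ne_zero hu0, hl] at hd
  have hu1 : u = C (coeff 0 u) := totalDegree_eq_zero_iff_eq_C.1 (by omega)
  refine ⟨fun j => f (i.succAbove j), fun j => hf _, coeff 0 u, ?_⟩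
  rw [← hu1]
  convert hp using 1
  rw [hpf, Fin.prod_univ_succAbove f i, hu]
  ring

lemma IsFund.line_ne {g : Fin 4 → MvPolynomial (Fin 2) ℝ} {c : ℝ}
    (hp : IsFund 5 X A (C c * (l * ∏ i, g i))) :
    (∀ i, ev (g i) A ≠ 0) ∧ ev l A ≠ 0 ∧
      ∀ B ∈ X, B ≠ A → ev l B = 0 ∨ ∃ i, ev (g i) B = 0 := by
  have h1 := hp.2.1
  rw [ev_mul, ev_mul, ev_prod] at h1
  have h2 := right_ne_zero_of_mul_eq_one h1
  refine ⟨fun i => Finset.prod_ne_zero_iff.1 (right_ne_zero_of_mul h2) i (Finset.mem_univ i),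
    left_ne_zero_of_mul h2, fun B hB hBA => ?_⟩
  have h3 := hp.2.2 B hB hBA
  rw [ev_mul, ev_mul, ev_prod, mul_eq_zero, mul_eq_zero, ev_C] at h3
  rcases h3 with h3 | h3 | h3
  · rw [ev_C, h3, zero_mul] at h1
    exact absurd h1 zero_ne_one
  · exact Or.inl h3
  · obtain ⟨i, -, hi⟩ := Finset.prod_eq_zero_iff.1 h3
    exact Or.inr ⟨i, hi⟩

lemma totalDegree_prod_le_card {ι : Type*} (s : Finset ι) {g : ι → MvPolynomial (Fin 2) ℝ}
    (hg : ∀ i, IsLinePoly (g i)) : (∏ i ∈ s, g i).totalDegree ≤ s.card := by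
  refine (totalDegree_finsetProd s g).trans ?_
  rw [Finset.sum_congr rfl fun i _ => hg i]
  simp

/-- The lines used by a node are pairwise distinct. -/
lemma IsFund.lineSet_ne {g : Fin 4 → MvPolynomial (Fin 2) ℝ} {c : ℝ}
    (hX : GCSet 5 (X : Set (ℝ × ℝ))) (hl : IsLinePoly l)
    (hg : ∀ i, IsLinePoly (g i)) (hp : IsFund 5 X A (C c * (l * ∏ i, g i))) (i j : Fin 4)
    (hij : i ≠ j) : lineSet (g i) ≠ lineSet (g j) := by
  classical
  intro heq
  obtain ⟨hgA, hlA, hcov⟩ := hp.line_ne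
  obtain ⟨M, hM, hMA, -⟩ := exists_isLinePoly_through A A
  have hq : l * ∏ k ∈ Finset.univ.erase j, g k = 0 := by
    refine hX.eq_zero_of_vanish hM ?_ fun B hB => ?_
    · refine (totalDegree_mul _ _).trans ?_
      have h := totalDegree_prod_le_card (Finset.univ.erase j) hg
      rw [Finset.card_erase_of_mem (Finset.mem_univ j), Finset.card_fin] at h
      rw [hl]
      omega
    · by_cases hBA : B = A
      · exact Or.inl (hBA ▸ hMA)
      right
      rw [ev_mul, ev_prod, mul_eq_zero, Finset.prod_eq_zero_iff]
      refine (hcov B hB hBA).imp_right ?_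
      rintro ⟨k, hk⟩
      by_cases hkj : k = j
      · refine ⟨i, by simp [hij], ?_⟩
        have : B ∈ lineSet (g j) := hkj ▸ hk
        rwa [← heq] at this
      · exact ⟨k, by simp [hkj], hk⟩
  have h := congrArg (ev · A) hq
  simp only [ev_mul, ev_prod, ev_zero, mul_eq_zero, hlA, false_or, Finset.prod_eq_zero_iff] at h
  obtain ⟨k, -, hk⟩ := h
  exact hgA k hk

open Classical in
lemma nodesOn_eq_card (X : Finset (ℝ × ℝ)) (l : MvPolynomial (Fin 2) ℝ) :
    nodesOn X l = (X.filter fun P => ev l P = 0).card := by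
  rw [← Set.ncard_coe_finset, nodesOn]
  congr 1
  ext P
  simp [lineSet]

/-- In the absence of maximal lines every line contains at most five nodes. -/
lemma GCSet.nodesOn_le_five (hX : GCSet 5 (X : Set (ℝ × ℝ)))
    (hnm : NoMaximalLine 5 (X : Set (ℝ × ℝ))) (hl : IsLinePoly l) : nodesOn X l ≤ 5 := by
  classical
  by_contra! h
  have h6 := hnm l hl
  rw [nodesOn_eq_card] at h h6
  obtain ⟨B, hB⟩ := Finset.card_pos.1 (by omega : 0 < (X.filter fun P => ev l P = 0).card)
  have hBX := Finset.mem_filter.1 hB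
  obtain ⟨p, hp, -⟩ := hX.2 B hBX.1
  have hdvd : l ∣ p := by
    refine hl.dvd_of_card_lt hp.1 ((X.filter fun P => ev l P = 0).erase B) ?_ ?_ ?_
    · rw [Finset.card_erase_of_mem hB]
      omega
    · intro P hP
      exact (Finset.mem_filter.1 (Finset.mem_of_mem_erase hP)).2
    · intro P hP
      exact hp.2.2 P (Finset.mem_filter.1 (Finset.mem_of_mem_erase hP)).1
        (Finset.ne_of_mem_erase hP)
  obtain ⟨q, rfl⟩ := hdvd
  have h1 := hp.2.1
  rw [ev_mul, hBX.2, zero_mul] at h1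
  exact zero_ne_one h1

/-- A used line contains at least two nodes. -/
lemma Uses.two_le_nodesOn (hX : GCSet 5 (X : Set (ℝ × ℝ))) (hl : IsLinePoly l)
    (h : Uses 5 X A l) : 2 ≤ nodesOn X l := by
  classical
  by_contra! hlt
  rw [nodesOn_eq_card] at hlt
  obtain ⟨P, hP⟩ : ∃ P, ∀ B ∈ X, ev l B = 0 → B = P := by
    obtain ⟨P, hP⟩ := Finset.card_le_one_iff_subset_singleton.1 (Nat.lt_succ_iff.1 hlt)
    exact ⟨P, fun B hB hlB => Finset.mem_singleton.1 (hP (Finset.mem_filter.2 ⟨hB, hlB⟩))⟩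
  obtain ⟨q, hq, -, hqA, hcov⟩ := h.exists_quartic hl
  obtain ⟨M, hM, hMA, hMP⟩ := exists_isLinePoly_through A P
  refine hqA ?_
  rw [hX.eq_zero_of_vanish hM hq fun B hB => ?_, ev_zero]
  by_cases hBA : B = A
  · exact Or.inl (hBA ▸ hMA)
  · exact (hcov B hB hBA).imp_left fun h => hP B hB h ▸ hMP

end GCSets

/-- The greedy pieces of a covering of a finite set partition it. -/
lemma card_eq_sum_greedy {α : Type*} {n : ℕ} (Z : Finset α) (p : Fin n → α → Prop)
    (h : ∀ P ∈ Z, ∃ i, p i P) :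
    Z.card = ∑ i, {P ∈ (Z : Set α) | p i P ∧ ∀ j < i, ¬ p j P}.ncard := by
  classical
  have hset : ∀ i, {P ∈ (Z : Set α) | p i P ∧ ∀ j < i, ¬ p j P} =
      (Z.filter fun P => p i P ∧ ∀ j < i, ¬ p j P : Finset α) := fun i => by
    ext P
    simp
  simp only [hset, Set.ncard_coe_finset]
  rw [← Finset.card_biUnion]
  · congr 1
    ext P
    simp only [Finset.mem_biUnion, Finset.mem_univ, true_and, Finset.mem_filter]
    refine ⟨fun hP => ?_, fun ⟨i, hP, _⟩ => hP⟩
    obtain ⟨i, hi, hmin⟩ := WellFounded.has_min (wellFounded_lt (α := Fin n)) {i | p i P} (h P hP)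
    exact ⟨i, hP, hi, fun j hj hjP => hmin j hjP hj⟩
  · intro i _ j _ hij
    refine Finset.disjoint_left.2 fun P hi hj => ?_
    rw [Finset.mem_filter] at hi hj
    rcases lt_or_gt_of_ne hij with hlt | hlt
    · exact hj.2.2 i hlt hi.2.1
    · exact hi.2.2 j hlt hj.2.1

section MDSequence

variable {X : Finset (ℝ × ℝ)} {A : ℝ × ℝ} {L : Fin 5 → MvPolynomial (Fin 2) ℝ}

lemma finite_resCount (X : Finset (ℝ × ℝ)) (L : Fin 5 → MvPolynomial (Fin 2) ℝ) (s : Fin 5)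
    (l : MvPolynomial (Fin 2) ℝ) :
    {B ∈ (X : Set (ℝ × ℝ)) | ev l B = 0 ∧ ∀ i : Fin 5, i < s → ev (L i) B ≠ 0}.Finite :=
  X.finite_toSet.subset fun _ h => h.1

lemma resCount_le_nodesOn (s : Fin 5) (l : MvPolynomial (Fin 2) ℝ) :
    resCount X L s l ≤ nodesOn X l :=
  Set.ncard_le_ncard (fun _ h => ⟨h.1, h.2.1⟩) (X.finite_toSet.inter_of_left _)

lemma resCount_anti {s t : Fin 5} (h : s ≤ t) (l : MvPolynomial (Fin 2) ℝ) :
    resCount X L t l ≤ resCount X L s l :=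
  Set.ncard_le_ncard (fun _ hB => ⟨hB.1, hB.2.1, fun i hi => hB.2.2 i (hi.trans_le h)⟩)
    (finite_resCount X L s l)

lemma IsFund.ev_ne_zero_and_cover {c : ℝ} (hp : IsFund 5 X A (C c * ∏ i, L i)) :
    (∀ i, ev (L i) A ≠ 0) ∧ ∀ B ∈ X, B ≠ A → ∃ i, ev (L i) B = 0 := by
  have h1 := hp.2.1
  rw [ev_mul, ev_prod] at h1
  refine ⟨fun i => Finset.prod_ne_zero_iff.1 (right_ne_zero_of_mul_eq_one h1) i
    (Finset.mem_univ i), fun B hB hBA => ?_⟩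
  have h2 := hp.2.2 B hB hBA
  rw [ev_mul, ev_prod, mul_eq_zero, Finset.prod_eq_zero_iff] at h2
  obtain ⟨i, -, hi⟩ := h2.resolve_left (by
    have := left_ne_zero_of_mul_eq_one h1
    rwa [ev_C] at this ⊢)
  exact ⟨i, hi⟩

lemma IsFund.sum_resCount {c : ℝ} (hX : GCSet 5 (X : Set (ℝ × ℝ))) (hA : A ∈ X)
    (hp : IsFund 5 X A (C c * ∏ i, L i)) : ∑ s, resCount X L s (L s) = 20 := by
  classical
  obtain ⟨hLA, hcov⟩ := hp.ev_ne_zero_and_cover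
  have h := card_eq_sum_greedy (X.erase A) (fun i B => ev (L i) B = 0) fun B hB =>
    hcov B (Finset.mem_of_mem_erase hB) (Finset.ne_of_mem_erase hB)
  rw [Finset.card_erase_of_mem hA, hX.card_eq] at h
  rw [show (20 : ℕ) = 21 - 1 from rfl, h]
  refine Finset.sum_congr rfl fun s _ => ?_
  unfold resCount
  congr 1
  ext B
  simp only [Set.mem_ofPred_eq, Finset.mem_coe, Finset.mem_erase]
  refine ⟨fun h => ⟨⟨?_, h.1⟩, h.2⟩, fun h => ⟨h.1.2, h.2⟩⟩
  intro hBA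
  exact hLA s (hBA ▸ h.2.1)

/-- Each used line has two nodes lying on none of the other used lines. -/
lemma IsFund.two_le_resCount_last {c : ℝ} (hX : GCSet 5 (X : Set (ℝ × ℝ)))
    (hL : ∀ i, IsLinePoly (L i)) (hp : IsFund 5 X A (C c * ∏ i, L i)) :
    2 ≤ resCount X L 4 (L 4) := by
  classical
  obtain ⟨hLA, hcov⟩ := hp.ev_ne_zero_and_cover
  by_contra! hlt
  obtain ⟨P, hP⟩ : ∃ P, ∀ B ∈ X, ev (L 4) B = 0 → (∀ i : Fin 5, i < 4 → ev (L i) B ≠ 0) →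
      B = P := by
    by_cases hne : ∃ P ∈ X, ev (L 4) P = 0 ∧ ∀ i : Fin 5, i < 4 → ev (L i) P ≠ 0
    · obtain ⟨P, hP⟩ := hne
      exact ⟨P, fun B hB h h' => (Set.ncard_le_one_iff (finite_resCount X L 4 (L 4))).1
        (Nat.lt_succ_iff.1 hlt) ⟨hB, h, h'⟩ hP⟩
    · exact ⟨A, fun B hB h h' => (hne ⟨B, hB, h, h'⟩).elim⟩
  obtain ⟨M, hM, hMA, hMP⟩ := exists_isLinePoly_through A P
  have hq : ∏ i ∈ Finset.univ.erase 4, L i = 0 := by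
    refine hX.eq_zero_of_vanish hM ((totalDegree_prod_le_card _ hL).trans (by simp))
      fun B hB => ?_
    by_cases hBA : B = A
    · exact Or.inl (hBA ▸ hMA)
    by_cases h4 : ∀ i : Fin 5, i < 4 → ev (L i) B ≠ 0
    · obtain ⟨i, hi⟩ := hcov B hB hBA
      have hi4 : i = 4 := (Fin.le_last i).eq_of_not_lt fun hlt => h4 i hlt hi
      exact Or.inl (hP B hB (hi4 ▸ hi) h4 ▸ hMP)
    · push Not at h4
      obtain ⟨i, hi, hiB⟩ := h4
      rw [ev_prod]
      exact Or.inr (Finset.prod_eq_zero (Finset.mem_erase.2 ⟨hi.ne, Finset.mem_univ i⟩) hiB)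
  exact Finset.prod_ne_zero_iff.2 (fun i _ => (hL i).ne_zero) hq

/-- If the first three lines used by a node carry `5 + 5 + 5` nodes, then the node has m-d sequence
`(5, 5, 5, 3, 2)`. -/
lemma IsFund.hasMDSeq {c : ℝ} (hX : GCSet 5 (X : Set (ℝ × ℝ)))
    (hnm : NoMaximalLine 5 (X : Set (ℝ × ℝ))) (hA : A ∈ X) (hL : ∀ i, IsLinePoly (L i))
    (hp : IsFund 5 X A (C c * ∏ i, L i)) (h5 : ∀ s < 3, 5 ≤ resCount X L s (L s)) :
    HasMDSeq X A ![5, 5, 5, 3, 2] := by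
  wlog hle : resCount X L 3 (L 4) ≤ resCount X L 3 (L 3) generalizing L
  · have hfix : ∀ i : Fin 5, i < 3 → Equiv.swap (3 : Fin 5) 4 i = i := by decide
    have hres : ∀ s ≤ 3, ∀ l, resCount X (L ∘ Equiv.swap 3 4) s l = resCount X L s l := by
      intro s hs l
      unfold resCount
      congr 1
      ext B
      simp +contextual only [Set.mem_ofPred_eq, Function.comp_apply,
        fun i (hi : i < s) => hfix i (hi.trans_le hs)]
    refine this (L := L ∘ Equiv.swap 3 4) (fun i => hL _) ?_ (fun s hs => ?_) ?_
    · simp only [Function.comp_apply]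
      rwa [Equiv.prod_comp (Equiv.swap 3 4) L]
    · rw [hres s hs.le, Function.comp_apply, hfix s hs]
      exact h5 s hs
    · rw [hres 3 le_rfl, hres 3 le_rfl]
      simp only [Function.comp_apply, Equiv.swap_apply_left, Equiv.swap_apply_right]
      exact (not_le.1 hle).le
  have hle5 : ∀ s t, resCount X L s (L t) ≤ 5 := fun s t =>
    (resCount_le_nodesOn s _).trans (hX.nodesOn_le_five hnm (hL t))
  have hsum := hp.sum_resCount hX hA
  have h4 := hp.two_le_resCount_last hX hL
  have h34 := resCount_anti (X := X) (L := L) (show (3 : Fin 5) ≤ 4 by decide) (L 4)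
  have e0 := h5 0 (by decide)
  have e1 := h5 1 (by decide)
  have e2 := h5 2 (by decide)
  have l0 := hle5 0 0
  have l1 := hle5 1 1
  have l2 := hle5 2 2
  rw [Fin.sum_univ_five] at hsum
  have hk : ∀ s, resCount X L s (L s) = ![5, 5, 5, 3, 2] s := by
    intro s
    fin_cases s <;> simp <;> omega
  have hne : ∀ i j : Fin 5, i < j → lineSet (L i) ≠ lineSet (L j) := by
    intro i j hij heq
    have hpos : resCount X L j (L j) ≠ 0 := by
      rw [hk]
      fin_cases j <;> simp
    obtain ⟨B, -, hB, hB'⟩ := Set.nonempty_of_ncard_ne_zero hpos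
    have hBj : B ∈ lineSet (L j) := hB
    rw [← heq] at hBj
    exact hB' i hij hBj
  refine ⟨L, ⟨hL, fun i j hij => ?_, ⟨_, hp, c, rfl⟩, fun s t hst => ?_⟩, hk⟩
  · rcases lt_or_gt_of_ne hij with h | h
    · exact hne i j h
    · exact (hne j i h).symm
  · rcases lt_or_ge s 3 with hs | hs
    · exact (hle5 s t).trans (h5 s hs)
    · obtain rfl | ⟨rfl, rfl⟩ := (by decide : ∀ s t : Fin 5, 3 ≤ s → s ≤ t →
        s = t ∨ s = 3 ∧ t = 4) s t hs hst
      · exact le_rfl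
      · exact hle

end MDSequence

/-- Two polynomials have a nontrivial combination with affine coefficients that vanishes at
prescribed points, at most five in number. -/
lemma exists_affine_combination (q r : MvPolynomial (Fin 2) ℝ) (Y : Finset (ℝ × ℝ))
    (hY : Y.card < 6) : ∃ v : Fin 6 → ℝ, v ≠ 0 ∧
      ∀ P ∈ Y, ev (affinePoly (v 0) (v 1) (v 2) * q + affinePoly (v 3) (v 4) (v 5) * r) P = 0 := by
  let f : (Fin 6 → ℝ) →ₗ[ℝ] (Y → ℝ) :=
    { toFun := fun v P => ev (affinePoly (v 0) (v 1) (v 2) * q + affinePoly (v 3) (v 4) (v 5) * r) P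
      map_add' := fun v w => by
        ext P
        simp only [ev_add, ev_mul, ev_affinePoly, Pi.add_apply]
        ring
      map_smul' := fun a v => by
        ext P
        simp only [ev_add, ev_mul, ev_affinePoly, Pi.smul_apply, smul_eq_mul, RingHom.id_apply]
        ring }
  obtain ⟨v, hv, hv0⟩ := (Submodule.ne_bot_iff _).1
    (LinearMap.ker_ne_bot_of_finrank_lt (f := f) (by simpa using hY))
  exact ⟨v, hv0, fun P hP => congrFun (LinearMap.mem_ker.1 hv) ⟨P, hP⟩⟩

section UsageBounds

variable {X : Finset (ℝ × ℝ)} {A B : ℝ × ℝ} {l : MvPolynomial (Fin 2) ℝ}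

open Classical in
/-- If `∏ h i` completes a 3-node line to the fundamental polynomial of `A`, and no `h i` contains
more than four of the remaining nodes, then no second node `B` uses the 3-node line. -/
lemma GCSet.not_two_users_of_card_le_four (hX : GCSet 5 (X : Set (ℝ × ℝ))) (hl3 : nodesOn X l = 3)
    {h : Fin 4 → MvPolynomial (Fin 2) ℝ} (hh : ∀ i, IsLinePoly (h i)) (hB : B ∈ X)
    (hAB : A ≠ B) (hlB : ev l B ≠ 0)
    (hcov : ∀ P ∈ X, P ≠ A → ev l P = 0 ∨ ∃ i, ev (h i) P = 0)
    {q : MvPolynomial (Fin 2) ℝ} (hq : q.totalDegree ≤ 4) (hqB : ev q B ≠ 0)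
    (hqcov : ∀ P ∈ X, P ≠ B → ev l P = 0 ∨ ev q P = 0)
    (h4 : ∀ i, (X.filter fun P => (ev l P ≠ 0 ∧ P ≠ A ∧ P ≠ B) ∧ ev (h i) P = 0).card ≤ 4) :
    False := by
  rw [nodesOn_eq_card] at hl3
  obtain ⟨v, hv0, hv⟩ := exists_affine_combination (∏ i, h i) q
    ({A, B} ∪ X.filter fun P => ev l P = 0) (by
      have h1 := Finset.card_union_le {A, B} (X.filter fun P => ev l P = 0)
      have h2 := Finset.card_le_two (a := A) (b := B)
      omega)
  set L := affinePoly (v 0) (v 1) (v 2) with hL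
  set M := affinePoly (v 3) (v 4) (v 5) with hM
  have hLd : L.totalDegree ≤ 1 := totalDegree_affinePoly_le _ _ _
  have hMd : M.totalDegree ≤ 1 := totalDegree_affinePoly_le _ _ _
  have hpd : (∏ i, h i).totalDegree ≤ 4 := totalDegree_prod_le_card _ hh
  have hF : L * ∏ i, h i + M * q = 0 := by
    refine hX.1.2.2 _ ((totalDegree_add _ _).trans (max_le ?_ ?_)) fun P hP => ?_
    · exact (totalDegree_mul _ _).trans (by omega)
    · exact (totalDegree_mul _ _).trans (by omega)
    · by_cases hPY : P ∈ ({A, B} ∪ X.filter fun P => ev l P = 0 : Finset (ℝ × ℝ))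
      · exact hv P hPY
      · simp only [Finset.mem_union, Finset.mem_insert, Finset.mem_singleton, Finset.mem_filter,
          not_or, not_and] at hPY
        obtain ⟨⟨hPA, hPB⟩, hPl⟩ := hPY
        obtain ⟨i, hi⟩ := (hcov P hP hPA).resolve_left (hPl hP)
        rw [ev_add, ev_mul, ev_mul, ev_prod, Finset.prod_eq_zero (Finset.mem_univ i) hi,
          (hqcov P hP hPB).resolve_left (hPl hP)]
        ring
  have hM0 : M ≠ 0 := by
    intro hM0
    rw [hM0, zero_mul, add_zero, mul_eq_zero] at hF
    have hL0 := hF.resolve_right (Finset.prod_ne_zero_iff.2 fun i _ => (hh i).ne_zero)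
    refine hv0 (funext fun i => ?_)
    have e1 := mt affinePoly_ne_zero (not_not.2 hL0)
    have e2 := mt affinePoly_ne_zero (not_not.2 hM0)
    push Not at e1 e2
    fin_cases i
    exacts [e1.1, e1.2.1, e1.2.2, e2.1, e2.2.1, e2.2.2]
  obtain ⟨j, hj⟩ := (hcov B hB hAB.symm).resolve_left hlB
  have hndvd : ¬ h j ∣ q := by
    rintro ⟨u, rfl⟩
    rw [ev_mul, hj, zero_mul] at hqB
    exact hqB rfl
  rw [← Finset.mul_prod_erase Finset.univ h (Finset.mem_univ j)] at hF
  obtain ⟨w, hw⟩ : h j ∣ M := by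
    refine ((hh j).prime.dvd_or_dvd ?_).resolve_right hndvd
    refine (dvd_add_right ?_).1 (hF ▸ dvd_zero _)
    exact Dvd.intro_left (L * ∏ i ∈ Finset.univ.erase j, h i) (by ring)
  have hw0 : w ≠ 0 := by
    rintro rfl
    exact hM0 (by rw [hw, mul_zero])
  have hF' : L * ∏ i ∈ Finset.univ.erase j, h i + w * q = 0 := by
    refine (mul_eq_zero.1 (?_ : h j * _ = 0)).resolve_left (hh j).ne_zero
    rw [← hF, hw]
    ring
  have hev : ∀ P, ev L P * ∏ i ∈ Finset.univ.erase j, ev (h i) P + ev w P * ev q P = 0 := by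
    intro P
    rw [← ev_prod, ← ev_mul, ← ev_mul, ← ev_add, hF', ev_zero]
  set Z := X.filter fun P => ev l P ≠ 0 ∧ P ≠ A ∧ P ≠ B with hZ
  have hZcard : 16 ≤ Z.card := by
    have h1 := Finset.card_filter_add_card_filter_not (s := X) fun P => ev l P = 0
    have h2 : (X.filter fun P => ¬ ev l P = 0) ⊆ {A, B} ∪ Z := by
      intro P hP
      simp only [hZ, Finset.mem_union, Finset.mem_insert, Finset.mem_singleton,
        Finset.mem_filter] at hP ⊢
      tauto
    have h3 := (Finset.card_le_card h2).trans (Finset.card_union_le _ _)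
    have h4 := Finset.card_le_two (a := A) (b := B)
    rw [hX.card_eq, hl3] at h1
    omega
  have hdvd : h j ∣ L := by
    refine (hh j).dvd_of_card_lt hLd
      (Z \ (Finset.univ.erase j).biUnion fun i => Z.filter fun P => ev (h i) P = 0) ?_ ?_ ?_
    · have h1 : ((Finset.univ.erase j).biUnion fun i => Z.filter fun P => ev (h i) P = 0).card
          ≤ (Finset.univ.erase j).card * 4 := by
        refine Finset.card_biUnion_le_card_mul (Finset.univ.erase j) _ 4 fun i _ => ?_
        rw [hZ, Finset.filter_filter]
        exact h4 i
      rw [Finset.card_erase_of_mem (Finset.mem_univ j), Finset.card_fin] at h1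
      have h2 := Finset.le_card_sdiff
        ((Finset.univ.erase j).biUnion fun i => Z.filter fun P => ev (h i) P = 0) Z
      omega
    all_goals
      intro P hP
      simp only [hZ, Finset.mem_sdiff, Finset.mem_filter, Finset.mem_biUnion, Finset.mem_erase,
        Finset.mem_univ, and_true, not_exists, not_and] at hP
      obtain ⟨⟨hPX, hlP, hPA, hPB⟩, hPj⟩ := hP
    · obtain ⟨i, hi⟩ := (hcov P hPX hPA).resolve_left hlP
      by_cases hij : i = j
      · exact hij ▸ hi
      · exact (hPj i hij ⟨hPX, hlP, hPA, hPB⟩ hi).elim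
    · have h1 := hev P
      rw [(hqcov P hPX hPB).resolve_left hlP, mul_zero, add_zero, mul_eq_zero] at h1
      refine h1.resolve_right (Finset.prod_ne_zero_iff.2 fun i hi => ?_)
      exact hPj i (Finset.ne_of_mem_erase hi) ⟨hPX, hlP, hPA, hPB⟩
  obtain ⟨u, hu⟩ := hdvd
  have hwB : ev w B = 0 := by
    have h1 := hev B
    rw [hu, ev_mul, hj, zero_mul, zero_mul, zero_add, mul_eq_zero] at h1
    exact h1.resolve_right hqB
  have hwd : w.totalDegree = 0 := by
    rw [hw, totalDegree_mul_of_isDomain (hh j).ne_zero hw0, hh j] at hMd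
    omega
  rw [totalDegree_eq_zero_iff_eq_C.1 hwd, ev_C] at hwB
  rw [totalDegree_eq_zero_iff_eq_C.1 hwd, hwB, C_0] at hw0
  exact hw0 rfl

open Classical in
/-- The points of `Z` lying on the line `h t` but on none of the lines `h j` with `j < i`. -/
noncomputable def greedyPiece (Z : Finset (ℝ × ℝ)) (h : Fin 4 → MvPolynomial (Fin 2) ℝ)
    (i t : Fin 4) : Finset (ℝ × ℝ) :=
  Z.filter fun P => ev (h t) P = 0 ∧ ∀ j < i, ev (h j) P ≠ 0

lemma mem_greedyPiece {Z : Finset (ℝ × ℝ)} {h : Fin 4 → MvPolynomial (Fin 2) ℝ} {i t : Fin 4}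
    {P : ℝ × ℝ} :
    P ∈ greedyPiece Z h i t ↔ P ∈ Z ∧ ev (h t) P = 0 ∧ ∀ j < i, ev (h j) P ≠ 0 := by
  simp [greedyPiece]

lemma ncard_eq_card_greedyPiece (Z : Finset (ℝ × ℝ)) (h : Fin 4 → MvPolynomial (Fin 2) ℝ)
    (i t : Fin 4) :
    {P ∈ (Z : Set (ℝ × ℝ)) | ev (h t) P = 0 ∧ ∀ j < i, ¬ ev (h j) P = 0}.ncard =
      (greedyPiece Z h i t).card := by
  rw [← Set.ncard_coe_finset]
  congr 1
  ext P
  simp [mem_greedyPiece]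

lemma Uses.notMem_lineSet (hl : IsLinePoly l) (h : Uses 5 X A l) : ev l A ≠ 0 :=
  let ⟨_, _, hlA, _⟩ := h.exists_quartic hl
  hlA

open Classical in
/-- The other four lines used by one of the users `U` of a line `l` can be ordered greedily with
respect to the nodes outside `l` and `U`; the sizes of the greedy pieces bound the number of users
of `l`. -/
lemma GCSet.exists_greedy_completion (hX : GCSet 5 (X : Set (ℝ × ℝ))) (hl : IsLinePoly l)
    {U : Finset (ℝ × ℝ)} (hUX : U ⊆ X) (hU : ∀ D ∈ U, Uses 5 X D l) (hA : A ∈ U) :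
    ∃ h : Fin 4 → MvPolynomial (Fin 2) ℝ, (∀ i, IsLinePoly (h i)) ∧
      (∃ c : ℝ, IsFund 5 X A (C c * (l * ∏ i, h i))) ∧
      ∃ Z : Finset (ℝ × ℝ), (∀ P, P ∈ Z ↔ P ∈ X ∧ ev l P ≠ 0 ∧ P ∉ U) ∧
        (∀ i t, i ≤ t → (greedyPiece Z h i t).card ≤ (greedyPiece Z h i i).card) ∧
        ∑ i, (greedyPiece Z h i i).card + nodesOn X l + U.card = 21 ∧
        U.card ≤ 1 + ∑ i : Fin 4, (5 - (i : ℕ) - (greedyPiece Z h i i).card) := by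
  obtain ⟨g, hg, c, hp⟩ := (hU A hA).exists_isFund_prod hX (hUX hA) hl
  set Z := (X.filter fun P => ¬ ev l P = 0) \ U with hZdef
  have hZ : ∀ P, P ∈ Z ↔ P ∈ X ∧ ev l P ≠ 0 ∧ P ∉ U := fun P => by
    simp [hZdef, and_assoc]
  obtain ⟨σ, hσ⟩ := exists_greedy_perm Z fun i P => ev (g i) P = 0
  have hp' : IsFund 5 X A (C c * (l * ∏ i, g (σ i))) := by
    rwa [Equiv.prod_comp σ g]
  obtain ⟨-, -, hcov⟩ := hp'.line_ne
  have hcovU : ∀ P ∈ X, P ≠ A → ev l P ≠ 0 → ∃ i, ev (g (σ i)) P = 0 := fun P hP hPA hlP =>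
    (hcov P hP hPA).resolve_left hlP
  refine ⟨fun i => g (σ i), fun i => hg _, ⟨c, hp'⟩, Z, hZ, fun i t hit => ?_, ?_, ?_⟩
  · rw [← ncard_eq_card_greedyPiece, ← ncard_eq_card_greedyPiece]
    exact hσ i t hit
  · have h1 := card_eq_sum_greedy Z (fun i P => ev (g (σ i)) P = 0) fun P hP =>
      hcovU P ((hZ P).1 hP).1 (fun h => ((hZ P).1 hP).2.2 (h ▸ hA)) ((hZ P).1 hP).2.1
    have h2 := Finset.card_filter_add_card_filter_not (s := X) fun P => ev l P = 0
    have h3 : Z.card + U.card = (X.filter fun P => ¬ ev l P = 0).card :=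
      Finset.card_sdiff_add_card_eq_card fun D hD =>
        Finset.mem_filter.2 ⟨hUX hD, (hU D hD).notMem_lineSet hl⟩
    rw [hX.card_eq, ← nodesOn_eq_card] at h2
    have h4 := fun i => ncard_eq_card_greedyPiece Z (fun i => g (σ i)) i i
    simp only [h4] at h1
    omega
  · have hquart : ∀ D, ∃ q : MvPolynomial (Fin 2) ℝ, D ∈ U → q.totalDegree ≤ 4 ∧ ev q D ≠ 0 ∧
        ∀ P ∈ X, P ≠ D → ev l P = 0 ∨ ev q P = 0 := fun D => by
      by_cases hD : D ∈ U
      · obtain ⟨q, hq, -, hqD, hqcov⟩ := (hU D hD).exists_quartic hl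
        exact ⟨q, fun _ => ⟨hq, hqD, hqcov⟩⟩
      · exact ⟨0, fun h => (hD h).elim⟩
    choose q hq using hquart
    have hmem : ∀ D ∈ U.erase A, D ∈ U := fun D hD => Finset.mem_of_mem_erase hD
    have hle := card_le_sum_deficit (fun i => g (σ i)) (fun i => hg _)
      (fun i j hij => hp'.lineSet_ne hX hl (fun i => hg _) i j hij) (U.erase A) q
      (fun D hD => (hq D (hmem D hD)).1) (fun D hD => (hq D (hmem D hD)).2.1)
      (fun D hD E hE hED => ((hq D (hmem D hD)).2.2 E (hUX (hmem E hE)) hED).resolve_left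
        ((hU E (hmem E hE)).notMem_lineSet hl))
      (fun i => greedyPiece Z (fun i => g (σ i)) i i)
      (fun i P hP => (mem_greedyPiece.1 hP).2.1)
      (fun i j hj P hP => (mem_greedyPiece.1 hP).2.2 j hj)
      (fun D hD i P hP => by
        obtain ⟨hPX, hlP, hPU⟩ := (hZ P).1 (mem_greedyPiece.1 hP).1
        exact ((hq D (hmem D hD)).2.2 P hPX fun h => hPU (h ▸ hmem D hD)).resolve_left hlP)
      (fun D hD => hcovU D (hUX (hmem D hD)) (Finset.ne_of_mem_erase hD)
        ((hU D (hmem D hD)).notMem_lineSet hl))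
    rw [Finset.card_erase_of_mem hA] at hle
    omega

/-- A 2-node or 3-node line has at most one user, a 4-node line at most three and a 5-node line at
most four. -/
lemma GCSet.not_users (hX : GCSet 5 (X : Set (ℝ × ℝ))) (hnm : NoMaximalLine 5 (X : Set (ℝ × ℝ)))
    (hmd : ∀ A ∈ X, ¬ HasMDSeq X A ![5, 5, 5, 3, 2]) (hl : IsLinePoly l) {U : Finset (ℝ × ℝ)}
    (hUX : U ⊆ X) (hU : ∀ D ∈ U, Uses 5 X D l)
    (hcard : nodesOn X l = 2 ∧ U.card = 2 ∨ nodesOn X l = 3 ∧ U.card = 2 ∨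
      nodesOn X l = 4 ∧ U.card = 4 ∨ nodesOn X l = 5 ∧ U.card = 5) : False := by
  classical
  obtain ⟨A, hA⟩ := Finset.card_pos.1 (by omega : 0 < U.card)
  obtain ⟨h, hh, ⟨c, hp⟩, Z, hZ, hgreedy, hsum, hle⟩ := hX.exists_greedy_completion hl hUX hU hA
  have hanti : ∀ i j : Fin 4, i ≤ j → (greedyPiece Z h j j).card ≤ (greedyPiece Z h i i).card :=
    fun i j hij => (Finset.card_le_card fun P hP => by
      rw [mem_greedyPiece] at hP ⊢
      exact ⟨hP.1, hP.2.1, fun k hk => hP.2.2 k (hk.trans_le hij)⟩).trans (hgreedy i j hij)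
  have k01 := hanti 0 1 (by decide)
  have k12 := hanti 1 2 (by decide)
  have k23 := hanti 2 3 (by decide)
  have k0 : (greedyPiece Z h 0 0).card ≤ 5 := by
    refine le_trans ?_ (hX.nodesOn_le_five hnm (hh 0))
    rw [nodesOn_eq_card]
    refine Finset.card_le_card fun P hP => ?_
    rw [mem_greedyPiece, hZ] at hP
    exact Finset.mem_filter.2 ⟨hP.1.1, hP.2.1⟩
  rw [Fin.sum_univ_four] at hsum hle
  simp only [Fin.coe_ofNat_eq_mod, Nat.zero_mod, Nat.one_mod, Nat.reduceMod, Nat.sub_zero] at hle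
  have hcases : nodesOn X l = 5 ∧ 5 ≤ (greedyPiece Z h 0 0).card ∧ 5 ≤ (greedyPiece Z h 1 1).card ∨
      5 ≤ (greedyPiece Z h 0 0).card ∧ 5 ≤ (greedyPiece Z h 1 1).card ∧
        5 ≤ (greedyPiece Z h 2 2).card ∨
      nodesOn X l = 3 ∧ U.card = 2 ∧ (greedyPiece Z h 0 0).card ≤ 4 := by
    omega
  have hpiece : ∀ (L : Fin 5 → MvPolynomial (Fin 2) ℝ) (s : Fin 5) (i : Fin 4), L s = h i →
      (∀ t < s, L t = l ∨ ∃ j < i, L t = h j) →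
      (greedyPiece Z h i i).card ≤ resCount X L s (L s) := by
    intro L s i hsi ht
    rw [← Set.ncard_coe_finset]
    refine Set.ncard_le_ncard (fun P hP => ?_) (finite_resCount X L s _)
    rw [Finset.mem_coe, mem_greedyPiece, hZ] at hP
    refine ⟨hP.1.1, hsi ▸ hP.2.1, fun t hts => ?_⟩
    rcases ht t hts with h' | ⟨j, hj, h'⟩
    · exact h' ▸ hP.1.2.1
    · exact h' ▸ hP.2.2 j hj
  have hsmall : ∀ s : Fin 5, s < 3 → s = 0 ∨ s = 1 ∨ s = 2 := by decide
  have hlt_two : ∀ t : Fin 5, t < 2 → t = 0 ∨ t = 1 := by decide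
  rcases hcases with ⟨hl5, h0, h1⟩ | ⟨h0, h1, h2⟩ | ⟨hl3, hU2, h0⟩
  · refine hmd A (hUX hA) (IsFund.hasMDSeq (L := ![l, h 0, h 1, h 2, h 3]) (c := c) hX hnm
      (hUX hA) ?_ ?_ ?_)
    · intro i
      fin_cases i
      exacts [hl, hh 0, hh 1, hh 2, hh 3]
    · convert hp using 2
      simp only [Fin.prod_univ_five, Fin.prod_univ_four]
      simp [mul_assoc]
    · intro s hs
      obtain rfl | rfl | rfl := hsmall s hs
      · refine hl5.symm.le.trans (Set.ncard_le_ncard (fun P hP => ?_) (finite_resCount X _ _ _))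
        exact ⟨hP.1, hP.2, fun t ht => (Fin.not_lt_zero t ht).elim⟩
      · refine h0.trans (hpiece _ _ 0 rfl fun t ht => Or.inl ?_)
        rw [(Fin.lt_one_iff t).1 ht]
        rfl
      · refine h1.trans (hpiece _ _ 1 rfl fun t ht => ?_)
        obtain rfl | rfl := hlt_two t ht
        exacts [Or.inl rfl, Or.inr ⟨0, by decide, rfl⟩]
  · refine hmd A (hUX hA) (IsFund.hasMDSeq (L := ![h 0, h 1, h 2, h 3, l]) (c := c) hX hnm
      (hUX hA) ?_ ?_ ?_)
    · intro i
      fin_cases i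
      exacts [hh 0, hh 1, hh 2, hh 3, hl]
    · convert hp using 2
      simp only [Fin.prod_univ_five, Fin.prod_univ_four]
      simp [mul_comm]
    · intro s hs
      obtain rfl | rfl | rfl := hsmall s hs
      · exact h0.trans (hpiece _ _ 0 rfl fun t ht => (Fin.not_lt_zero t ht).elim)
      · refine h1.trans (hpiece _ _ 1 rfl fun t ht => Or.inr ⟨0, by decide, ?_⟩)
        rw [(Fin.lt_one_iff t).1 ht]
        rfl
      · refine h2.trans (hpiece _ _ 2 rfl fun t ht => Or.inr ?_)
        obtain rfl | rfl := hlt_two t ht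
        exacts [⟨0, by decide, rfl⟩, ⟨1, by decide, rfl⟩]
  · obtain ⟨B, hB, hBA⟩ := Finset.exists_mem_ne (by omega : 1 < U.card) A
    have hUeq : U = {A, B} := by
      refine (Finset.eq_of_subset_of_card_le ?_ ?_).symm
      · intro P hP
        simp only [Finset.mem_insert, Finset.mem_singleton] at hP
        rcases hP with rfl | rfl <;> assumption
      · rw [hU2, Finset.card_pair hBA.symm]
    obtain ⟨q, hq, hlB, hqB, hqcov⟩ := (hU B hB).exists_quartic hl
    refine hX.not_two_users_of_card_le_four hl3 hh (hUX hB) hBA.symm hlB hp.line_ne.2.2 hq hqB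
      hqcov fun i => ((Finset.card_le_card fun P hP => ?_).trans
        (hgreedy 0 i (Fin.zero_le i))).trans h0
    rw [mem_greedyPiece, hZ, hUeq]
    simp only [Finset.mem_filter, Finset.mem_insert, Finset.mem_singleton, not_or] at hP ⊢
    exact ⟨⟨hP.1, hP.2.1.1, hP.2.1.2⟩, hP.2.2, fun j hj => (Fin.not_lt_zero j hj).elim⟩

open Classical in
/-- The points of `S` that use the line `s`. -/
noncomputable def users (X S : Finset (ℝ × ℝ)) (s : Set (ℝ × ℝ)) : Finset (ℝ × ℝ) :=
  S.filter fun B => ∃ l, IsLinePoly l ∧ lineSet l = s ∧ Uses 5 X B l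

lemma mem_users {S : Finset (ℝ × ℝ)} (hl : IsLinePoly l) :
    B ∈ users X S (lineSet l) ↔ B ∈ S ∧ Uses 5 X B l := by
  simp only [users, Finset.mem_filter, and_congr_right_iff]
  refine fun _ => ⟨?_, fun h => ⟨l, hl, rfl, h⟩⟩
  rintro ⟨l', -, hll', p, hp, hdvd⟩
  exact ⟨p, hp, (hl.dvd_of_lineSet_subset hll'.ge).trans hdvd⟩

lemma GCSet.card_users_le (hX : GCSet 5 (X : Set (ℝ × ℝ)))
    (hnm : NoMaximalLine 5 (X : Set (ℝ × ℝ))) (hmd : ∀ A ∈ X, ¬ HasMDSeq X A ![5, 5, 5, 3, 2])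
    (hl : IsLinePoly l) (h2 : 2 ≤ nodesOn X l) {S : Finset (ℝ × ℝ)} (hS : S ⊆ X) :
    (users X S (lineSet l)).card + 1 ≤ nodesOn X l ∧
      (nodesOn X l = 3 → (users X S (lineSet l)).card ≤ 1) := by
  have key : ∀ r ≤ (users X S (lineSet l)).card, ¬ (nodesOn X l = 2 ∧ r = 2 ∨
      nodesOn X l = 3 ∧ r = 2 ∨ nodesOn X l = 4 ∧ r = 4 ∨ nodesOn X l = 5 ∧ r = 5) := by
    intro r hr h
    obtain ⟨U, hU, rfl⟩ := Finset.exists_subset_card_eq hr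
    exact hX.not_users hnm hmd hl (fun D hD => hS ((mem_users hl).1 (hU hD)).1)
      (fun D hD => ((mem_users hl).1 (hU hD)).2) h
  have h5 := hX.nodesOn_le_five hnm hl
  have k2 := key 2
  have k4 := key 4
  have k5 := key 5
  omega

open Classical in
/-- The lines through `A` and another node. -/
noncomputable def pencil (X : Finset (ℝ × ℝ)) (A : ℝ × ℝ) : Finset (Set (ℝ × ℝ)) :=
  (X.erase A).image fun B => lineSet (exists_isLinePoly_through A B).choose

lemma lineSet_choose_through_eq (hl : IsLinePoly l) (hlA : ev l A = 0) (hlB : ev l B = 0)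
    (hBA : B ≠ A) : lineSet (exists_isLinePoly_through A B).choose = lineSet l :=
  let h := (exists_isLinePoly_through A B).choose_spec
  h.1.lineSet_eq_of_two_points hl hBA h.2.2 hlB h.2.1 hlA

lemma exists_of_mem_pencil {s : Set (ℝ × ℝ)} (hA : A ∈ X) (hs : s ∈ pencil X A) :
    ∃ l, IsLinePoly l ∧ lineSet l = s ∧ ev l A = 0 ∧ 2 ≤ nodesOn X l := by
  classical
  obtain ⟨B, hB, rfl⟩ := Finset.mem_image.1 hs
  obtain ⟨hl, hlA, hlB⟩ := (exists_isLinePoly_through A B).choose_spec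
  refine ⟨_, hl, rfl, hlA, ?_⟩
  rw [nodesOn_eq_card]
  exact Finset.one_lt_card.2 ⟨A, Finset.mem_filter.2 ⟨hA, hlA⟩, B,
    Finset.mem_filter.2 ⟨Finset.mem_of_mem_erase hB, hlB⟩, (Finset.ne_of_mem_erase hB).symm⟩

lemma lineSet_mem_pencil (hl : IsLinePoly l) (hlA : ev l A = 0) (h2 : 2 ≤ nodesOn X l) :
    lineSet l ∈ pencil X A := by
  classical
  rw [nodesOn_eq_card] at h2
  obtain ⟨B, hB, hBA⟩ := Finset.exists_mem_ne h2 A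
  rw [Finset.mem_filter] at hB
  exact Finset.mem_image.2
    ⟨B, Finset.mem_erase.2 ⟨hBA, hB.1⟩, lineSet_choose_through_eq hl hlA hB.2 hBA⟩

/-- The lines through a node partition the other nodes. -/
lemma sum_pencil (hA : A ∈ X) :
    ∑ s ∈ pencil X A, ((X ∩ s : Set (ℝ × ℝ)).ncard - 1) = X.card - 1 := by
  classical
  rw [← Finset.card_erase_of_mem hA, pencil, Finset.card_eq_sum_card_image
    (fun B => lineSet (exists_isLinePoly_through A B).choose) (X.erase A)]
  refine Finset.sum_congr rfl fun s hs => ?_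
  obtain ⟨l, hl, rfl, hlA, -⟩ := exists_of_mem_pencil hA hs
  rw [← nodesOn, nodesOn_eq_card, ← Finset.card_erase_of_mem (Finset.mem_filter.2 ⟨hA, hlA⟩)]
  congr 1
  ext B
  simp only [Finset.mem_erase, Finset.mem_filter]
  constructor
  · rintro ⟨hBA, hB, hlB⟩
    exact ⟨⟨hBA, hB⟩, lineSet_choose_through_eq hl hlA hlB hBA⟩
  · rintro ⟨⟨hBA, hB⟩, h⟩
    refine ⟨hBA, hB, ?_⟩
    have : B ∈ lineSet (exists_isLinePoly_through A B).choose :=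
      (exists_isLinePoly_through A B).choose_spec.2.2
    rwa [h] at this

/-- Every node uses a line through any given other node. -/
lemma GCSet.exists_uses_through (hX : GCSet 5 (X : Set (ℝ × ℝ))) (hA : A ∈ X) (hB : B ∈ X)
    (hBA : B ≠ A) : ∃ l, IsLinePoly l ∧ Uses 5 X B l ∧ ev l A = 0 := by
  obtain ⟨p, hp, f, hf, rfl⟩ := hX.2 B hB
  have h := hp.2.2 A hA hBA.symm
  rw [ev_prod, Finset.prod_eq_zero_iff] at h
  obtain ⟨i, hi, hiA⟩ := h
  exact ⟨f i, hf i, ⟨_, hp, Finset.dvd_prod_of_mem f hi⟩, hiA⟩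

open Classical in
/-- Double counting the pairs (node, used line through `A`): every line through `A` and another node
has one user less than nodes, and every other node uses exactly one line through `A`. -/
lemma GCSet.pencil_usage (hX : GCSet 5 (X : Set (ℝ × ℝ)))
    (hnm : NoMaximalLine 5 (X : Set (ℝ × ℝ))) (hmd : ∀ A ∈ X, ¬ HasMDSeq X A ![5, 5, 5, 3, 2])
    (hA : A ∈ X) :
    (∀ s ∈ pencil X A, (users X (X.erase A) s).card = (X ∩ s : Set (ℝ × ℝ)).ncard - 1) ∧
      ∀ B ∈ X.erase A, ((pencil X A).filter fun s => B ∈ users X (X.erase A) s).card = 1 := by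
  have hle : ∀ s ∈ pencil X A,
      (users X (X.erase A) s).card ≤ (X ∩ s : Set (ℝ × ℝ)).ncard - 1 := by
    intro s hs
    obtain ⟨l, hl, rfl, -, h2⟩ := exists_of_mem_pencil hA hs
    have h1 := (hX.card_users_le hnm hmd hl h2 (X.erase_subset A)).1
    rw [nodesOn] at h1
    omega
  have hge : ∀ B ∈ X.erase A,
      1 ≤ ((pencil X A).filter fun s => B ∈ users X (X.erase A) s).card := by
    intro B hB
    obtain ⟨l, hl, hBl, hlA⟩ := hX.exists_uses_through hA (Finset.mem_of_mem_erase hB)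
      (Finset.ne_of_mem_erase hB)
    exact Finset.card_pos.2 ⟨lineSet l, Finset.mem_filter.2
      ⟨lineSet_mem_pencil hl hlA (hBl.two_le_nodesOn hX hl), (mem_users hl).2 ⟨hB, hBl⟩⟩⟩
  have hdouble : ∑ B ∈ X.erase A, ((pencil X A).filter fun s => B ∈ users X (X.erase A) s).card =
      ∑ s ∈ pencil X A, (users X (X.erase A) s).card := by
    refine (Finset.sum_card_bipartiteAbove_eq_sum_card_bipartiteBelow
      fun B s => B ∈ users X (X.erase A) s).trans (Finset.sum_congr rfl fun s _ => ?_)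
    congr 1
    ext B
    simp [Finset.bipartiteBelow, users]
  have hsum := sum_pencil hA
  have h1 := Finset.sum_le_sum hle
  have h2 := Finset.sum_le_sum hge
  have h3 : ∑ _B ∈ X.erase A, 1 = X.card - 1 := by
    rw [← Finset.card_eq_sum_ones, Finset.card_erase_of_mem hA]
  refine ⟨(Finset.sum_eq_sum_iff_of_le hle).1 (by omega), fun B hB => ?_⟩
  exact ((Finset.sum_eq_sum_iff_of_le hge).1 (by omega) B hB).symm

end UsageBounds

/-- in a `GC_5` set with no maximal line and with no node of m-d sequence
`(5,5,5,3,2)`: (i) there is no 3-node line and every `m`-node line (`m ∈ {2,4,5}`) is used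
by exactly `m - 1` nodes; (ii) no two distinct lines used by the same node intersect at a
node of `X`. -/
theorem no_three_node_line_and_usage_count (X : Set (ℝ × ℝ)) (hX : GCSet 5 X)
    (hnm : NoMaximalLine 5 X) (h55532 : ∀ A ∈ X, ¬ HasMDSeq X A ![5, 5, 5, 3, 2]) :
    (∀ l : MvPolynomial (Fin 2) ℝ, IsLinePoly l → nodesOn X l ≠ 3) ∧
    (∀ l : MvPolynomial (Fin 2) ℝ, IsLinePoly l → ∀ m : ℕ, (m = 2 ∨ m = 4 ∨ m = 5) →
      nodesOn X l = m → {A | A ∈ X ∧ Uses 5 X A l}.ncard = m - 1) ∧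
    (∀ A ∈ X, ∀ l1 l2 : MvPolynomial (Fin 2) ℝ, IsLinePoly l1 → IsLinePoly l2 →
      Uses 5 X A l1 → Uses 5 X A l2 → lineSet l1 ≠ lineSet l2 →
      ∀ P ∈ X, ¬ (ev l1 P = 0 ∧ ev l2 P = 0)) := by

  obtain ⟨X, rfl⟩ := hX.1.1.exists_finset_coe
  refine ⟨fun l hl h3 => ?_, fun l hl m hm hlm => ?_,
    fun B hB l₁ l₂ hl₁ hl₂ hB₁ hB₂ hne P hP hP' => ?_⟩
  · obtain ⟨A, hA, hlA⟩ := Set.nonempty_of_ncard_ne_zero (s := X ∩ lineSet l)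
      (by rw [← nodesOn]; omega)
    have h1 := (hX.pencil_usage hnm h55532 hA).1 _ (lineSet_mem_pencil hl hlA (by omega))
    have h2 := (hX.card_users_le hnm h55532 hl (by omega) (X.erase_subset A)).2 h3
    rw [← nodesOn] at h1
    omega
  · obtain ⟨A, hA, hlA⟩ := Set.nonempty_of_ncard_ne_zero (s := X ∩ lineSet l)
      (by rw [← nodesOn]; omega)
    have h1 := (hX.pencil_usage hnm h55532 hA).1 _ (lineSet_mem_pencil hl hlA (by omega))
    have h2 := (hX.card_users_le hnm h55532 hl (by omega) (Finset.Subset.refl X)).1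
    have h3 : (users X (X.erase A) (lineSet l)).card ≤ (users X X (lineSet l)).card :=
      Finset.card_le_card fun B hB => (mem_users hl).2
        (((mem_users hl).1 hB).imp_left Finset.mem_of_mem_erase)
    have h4 : {A | A ∈ (X : Set (ℝ × ℝ)) ∧ Uses 5 X A l} = users X X (lineSet l) := by
      ext B
      rw [Finset.mem_coe, mem_users hl]
      rfl
    rw [h4, Set.ncard_coe_finset]
    rw [← nodesOn] at h1
    omega
  · classical
    have hBP : B ∈ X.erase P := by
      refine Finset.mem_erase.2 ⟨?_, hB⟩
      rintro rfl
      exact hB₁.notMem_lineSet hl₁ hP'.1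
    have hmem : ∀ l, IsLinePoly l → Uses 5 X B l → ev l P = 0 →
        lineSet l ∈ (pencil X P).filter fun s => B ∈ users X (X.erase P) s :=
      fun l hl hBl hlP => Finset.mem_filter.2
        ⟨lineSet_mem_pencil hl hlP (hBl.two_le_nodesOn hX hl), (mem_users hl).2 ⟨hBP, hBl⟩⟩
    have h1 := (hX.pencil_usage hnm h55532 hP).2 B hBP
    exact hne (Finset.card_le_one.1 h1.le _ (hmem l₁ hl₁ hB₁ hP'.1) _ (hmem l₂ hl₂ hB₂ hP'.2))
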